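/- arXiv:nlin/0107065 — 5 statements merged into one kernel-verified Lean document; each statement's English description precedes it below -/
import Mathlib

section
/- Let n ≥ 1 and let G, Ḡ : ℝ⁴ → Matrix (Fin n) (Fin n) ℂ be smooth with G(p), Ḡ(p) invertible for every p (here Ḡ is an independent matrix function, not a complex conjugate). Define A_y := G⁻¹∂_yG, A_z := G⁻¹∂_zG, A_ȳ := Ḡ⁻¹∂_ȳḠ, A_z̄ := Ḡ⁻¹∂_z̄Ḡ, and J := G·Ḡ⁻¹. Then: (1) F_{yz} = 0 and F_{ȳz̄} = 0 hold identically; (2) ∂_ȳ(J⁻¹∂_yJ) + ∂_z̄(J⁻¹∂_zJ) = −Ḡ·(F_{yȳ} + F_{zz̄})·Ḡ⁻¹ pointwise; consequently F_{yȳ} + F_{zz̄} = 0 holds if and only if J satisfies Yang's equation ∂_ȳ(J⁻¹∂_yJ) + ∂_z̄(J⁻¹∂_zJ) = 0. -/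
/-- Partial derivative of a matrix-valued function on `ℝ⁴` with respect to
coordinate `u`, taken entrywise. Coordinates: `0 = y`, `1 = z`, `2 = ȳ`, `3 = z̄`. -/
noncomputable def pd {n : ℕ} (u : Fin 4) (A : (Fin 4 → ℝ) → Matrix (Fin n) (Fin n) ℂ)
    (p : Fin 4 → ℝ) : Matrix (Fin n) (Fin n) ℂ :=
  Matrix.of fun i j => deriv (fun t => A (Function.update p u t) i j) (p u)

/-- All matrix entries are `C^∞`. -/
def IsSmoothMat {n : ℕ} (A : (Fin 4 → ℝ) → Matrix (Fin n) (Fin n) ℂ) : Prop :=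
  ∀ i j, ContDiff ℝ (⊤ : ℕ∞) fun p => A p i j

/-- Field strength `F_{uv} = ∂_u A_v − ∂_v A_u + A_u A_v − A_v A_u`. -/
noncomputable def fieldStrength {n : ℕ}
    (A : Fin 4 → (Fin 4 → ℝ) → Matrix (Fin n) (Fin n) ℂ)
    (u v : Fin 4) (p : Fin 4 → ℝ) : Matrix (Fin n) (Fin n) ℂ :=
  pd u (A v) p - pd v (A u) p + A u p * A v p - A v p * A u p

theorem IsSmoothMat.mul {n : ℕ} {A B : (Fin 4 → ℝ) → Matrix (Fin n) (Fin n) ℂ}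
    (hA : IsSmoothMat A) (hB : IsSmoothMat B) : IsSmoothMat fun p => A p * B p := by
  intro i j
  simp only [Matrix.mul_apply]
  exact ContDiff.sum fun k _ => (hA i k).mul (hB k j)

theorem IsSmoothMat.sub {n : ℕ} {A B : (Fin 4 → ℝ) → Matrix (Fin n) (Fin n) ℂ}
    (hA : IsSmoothMat A) (hB : IsSmoothMat B) : IsSmoothMat fun p => A p - B p :=
  fun i j => (hA i j).sub (hB i j)

theorem IsSmoothMat.det {n : ℕ} {A : (Fin 4 → ℝ) → Matrix (Fin n) (Fin n) ℂ}
    (hA : IsSmoothMat A) : ContDiff ℝ (⊤ : ℕ∞) fun p => (A p).det := by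
  simp only [Matrix.det_apply']
  exact ContDiff.sum fun σ _ => contDiff_const.mul (contDiff_prod fun i _ => hA (σ i) i)

theorem IsSmoothMat.inv {n : ℕ} {A : (Fin 4 → ℝ) → Matrix (Fin n) (Fin n) ℂ}
    (hA : IsSmoothMat A) (hu : ∀ p, IsUnit (A p)) : IsSmoothMat fun p => (A p)⁻¹ := by
  intro i j
  simp only [Matrix.inv_def, Ring.inverse_eq_inv', Matrix.smul_apply, Matrix.adjugate_apply,
    smul_eq_mul]
  refine (hA.det.inv fun p => ((Matrix.isUnit_iff_isUnit_det _).1 (hu p)).ne_zero).mul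
    (IsSmoothMat.det (A := fun p => (A p).updateRow j (Pi.single i 1)) fun k l => ?_)
  by_cases h : k = j
  · subst h
    simpa using contDiff_const
  · simpa [Matrix.updateRow_ne h] using hA k l

theorem IsSmoothMat.differentiableAt {n : ℕ} {A : (Fin 4 → ℝ) → Matrix (Fin n) (Fin n) ℂ}
    (hA : IsSmoothMat A) (i j : Fin n) (p : Fin 4 → ℝ) :
    DifferentiableAt ℝ (fun q => A q i j) p :=
  (hA i j).differentiable (by simp) p

theorem pd_apply {n : ℕ} {A : (Fin 4 → ℝ) → Matrix (Fin n) (Fin n) ℂ}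
    (hA : IsSmoothMat A) (u : Fin 4) (p : Fin 4 → ℝ) (i j : Fin n) :
    pd u A p i j = fderiv ℝ (fun q => A q i j) p (Pi.single u 1) := by
  have h : HasFDerivAt (fun q => A q i j) (fderiv ℝ (fun q => A q i j) p)
      (Function.update p u (p u)) := by
    simpa using (hA.differentiableAt i j p).hasFDerivAt
  exact (h.comp_hasDerivAt (p u) (hasDerivAt_update p u (p u))).deriv

theorem IsSmoothMat.pd {n : ℕ} {A : (Fin 4 → ℝ) → Matrix (Fin n) (Fin n) ℂ}
    (hA : IsSmoothMat A) (u : Fin 4) : IsSmoothMat (pd u A) := by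
  intro i j
  simp only [pd_apply hA]
  exact ((hA i j).fderiv_right (by simp)).clm_apply contDiff_const

theorem pd_comm {n : ℕ} {A : (Fin 4 → ℝ) → Matrix (Fin n) (Fin n) ℂ}
    (hA : IsSmoothMat A) (u v : Fin 4) (p : Fin 4 → ℝ) :
    pd u (pd v A) p = pd v (pd u A) p := by
  ext i j
  have hd : DifferentiableAt ℝ (fderiv ℝ fun q => A q i j) p :=
    ((hA i j).fderiv_right (m := 1) (by norm_cast)).differentiable (by simp) p
  have hs : IsSymmSndFDerivAt ℝ (fun q => A q i j) p :=
    (hA i j).contDiffAt.isSymmSndFDerivAt (by simp; norm_cast)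
  rw [pd_apply (hA.pd v), pd_apply (hA.pd u)]
  simp only [pd_apply hA]
  rw [fderiv_clm_apply hd (differentiableAt_const _), fderiv_clm_apply hd (differentiableAt_const _)]
  simpa using hs.eq (Pi.single u 1) (Pi.single v 1)

theorem pd_mul {n : ℕ} {A B : (Fin 4 → ℝ) → Matrix (Fin n) (Fin n) ℂ}
    (hA : IsSmoothMat A) (hB : IsSmoothMat B) (u : Fin 4) (p : Fin 4 → ℝ) :
    pd u (fun q => A q * B q) p = pd u A p * B p + A p * pd u B p := by
  ext i j
  rw [pd_apply (hA.mul hB)]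
  simp only [Matrix.add_apply, Matrix.mul_apply, pd_apply hA, pd_apply hB]
  rw [fderiv_fun_sum fun k _ => (hA.differentiableAt i k p).fun_mul (hB.differentiableAt k j p)]
  simp only [_root_.sum_apply, ← Finset.sum_add_distrib]
  refine Finset.sum_congr rfl fun k _ => ?_
  rw [fderiv_fun_mul (hA.differentiableAt i k p) (hB.differentiableAt k j p)]
  simp
  ring

theorem pd_sub {n : ℕ} {A B : (Fin 4 → ℝ) → Matrix (Fin n) (Fin n) ℂ}
    (hA : IsSmoothMat A) (hB : IsSmoothMat B) (u : Fin 4) (p : Fin 4 → ℝ) :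
    pd u (fun q => A q - B q) p = pd u A p - pd u B p := by
  ext i j
  rw [pd_apply (hA.sub hB)]
  simp only [Matrix.sub_apply, pd_apply hA, pd_apply hB]
  rw [fderiv_fun_sub (hA.differentiableAt i j p) (hB.differentiableAt i j p)]
  simp

theorem pd_const {n : ℕ} (C : Matrix (Fin n) (Fin n) ℂ) (u : Fin 4) (p : Fin 4 → ℝ) :
    pd u (fun _ => C) p = 0 := by
  ext i j
  simp [pd]

theorem mul_inv_of_isUnit {n : ℕ} {M : Matrix (Fin n) (Fin n) ℂ} (h : IsUnit M) : M * M⁻¹ = 1 :=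
  Matrix.mul_nonsing_inv _ ((Matrix.isUnit_iff_isUnit_det _).1 h)

theorem inv_mul_of_isUnit {n : ℕ} {M : Matrix (Fin n) (Fin n) ℂ} (h : IsUnit M) : M⁻¹ * M = 1 :=
  Matrix.nonsing_inv_mul _ ((Matrix.isUnit_iff_isUnit_det _).1 h)

theorem pd_inv {n : ℕ} {A : (Fin 4 → ℝ) → Matrix (Fin n) (Fin n) ℂ}
    (hA : IsSmoothMat A) (hu : ∀ p, IsUnit (A p)) (u : Fin 4) (p : Fin 4 → ℝ) :
    pd u (fun q => (A q)⁻¹) p = -((A p)⁻¹ * pd u A p * (A p)⁻¹) := by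
  have h := pd_mul (hA.inv hu) hA u p
  simp only [inv_mul_of_isUnit (hu _), pd_const] at h
  have h' := congrArg (· * (A p)⁻¹) h
  simp only [add_mul, zero_mul, mul_assoc, mul_inv_of_isUnit (hu p), mul_one] at h'
  rw [mul_assoc]
  exact eq_neg_of_add_eq_zero_left h'.symm

/-- The pure gauge potential `G⁻¹ ∂_u G`. -/
noncomputable def pureGauge {n : ℕ} (G : (Fin 4 → ℝ) → Matrix (Fin n) (Fin n) ℂ) (u : Fin 4)
    (p : Fin 4 → ℝ) : Matrix (Fin n) (Fin n) ℂ :=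
  (G p)⁻¹ * pd u G p

theorem IsSmoothMat.pureGauge {n : ℕ} {G : (Fin 4 → ℝ) → Matrix (Fin n) (Fin n) ℂ}
    (hG : IsSmoothMat G) (hu : ∀ p, IsUnit (G p)) (u : Fin 4) : IsSmoothMat (pureGauge G u) :=
  (hG.inv hu).mul (hG.pd u)

theorem pd_pureGauge {n : ℕ} {G : (Fin 4 → ℝ) → Matrix (Fin n) (Fin n) ℂ}
    (hG : IsSmoothMat G) (hu : ∀ p, IsUnit (G p)) (u v : Fin 4) (p : Fin 4 → ℝ) :
    pd u (pureGauge G v) p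
      = (G p)⁻¹ * pd u (pd v G) p - pureGauge G u p * pureGauge G v p := by
  unfold pureGauge
  rw [pd_mul (hG.inv hu) (hG.pd v), pd_inv hG hu]
  noncomm_ring

theorem fieldStrength_pureGauge {n : ℕ} {G : (Fin 4 → ℝ) → Matrix (Fin n) (Fin n) ℂ}
    (hG : IsSmoothMat G) (hu : ∀ p, IsUnit (G p)) (u v : Fin 4) (p : Fin 4 → ℝ) :
    fieldStrength (pureGauge G) u v p = 0 := by
  simp only [fieldStrength, pd_pureGauge hG hu, pd_comm hG u v]
  noncomm_ring

theorem pureGauge_mul_inv {n : ℕ} {G H : (Fin 4 → ℝ) → Matrix (Fin n) (Fin n) ℂ}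
    (hG : IsSmoothMat G) (hH : IsSmoothMat H) (huG : ∀ p, IsUnit (G p))
    (huH : ∀ p, IsUnit (H p)) (u : Fin 4) (p : Fin 4 → ℝ) :
    pureGauge (fun q => G q * (H q)⁻¹) u p
      = H p * (pureGauge G u p - pureGauge H u p) * (H p)⁻¹ := by
  have hinv : (G p * (H p)⁻¹)⁻¹ = H p * (G p)⁻¹ := by
    rw [Matrix.mul_inv_rev, Matrix.nonsing_inv_nonsing_inv _
      ((Matrix.isUnit_iff_isUnit_det _).1 (huH p))]
  have hGG : ∀ M, (G p)⁻¹ * (G p * M) = M := fun M => by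
    rw [← mul_assoc, inv_mul_of_isUnit (huG p), one_mul]
  simp only [pureGauge]
  rw [hinv, pd_mul hG (hH.inv huH), pd_inv hH huH]
  simp only [mul_add, mul_sub, sub_mul, mul_neg, mul_assoc, hGG]
  rw [sub_eq_add_neg]

/-- Differentiating a field conjugated by `H` gives the conjugated covariant derivative. -/
theorem pd_conj {n : ℕ} {H X : (Fin 4 → ℝ) → Matrix (Fin n) (Fin n) ℂ}
    (hH : IsSmoothMat H) (hX : IsSmoothMat X) (hu : ∀ p, IsUnit (H p))
    (v : Fin 4) (p : Fin 4 → ℝ) :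
    pd v (fun q => H q * X q * (H q)⁻¹) p
      = H p * (pd v X p + pureGauge H v p * X p - X p * pureGauge H v p) * (H p)⁻¹ := by
  have hHH : ∀ M, H p * ((H p)⁻¹ * M) = M := fun M => by
    rw [← mul_assoc, mul_inv_of_isUnit (hu p), one_mul]
  rw [pd_mul (hH.mul hX) (hH.inv hu), pd_mul hH hX, pd_inv hH hu]
  simp only [pureGauge, mul_add, mul_sub, add_mul, sub_mul, mul_neg, mul_assoc, hHH]
  abel

/-- The `v`-derivative of `J⁻¹ ∂_u J` for `J = G H⁻¹` is, up to sign, the conjugated mixed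
field strength of the potentials `A_u = G⁻¹ ∂_u G` and `A_v = H⁻¹ ∂_v H`. -/
theorem pd_pureGauge_mul_inv {n : ℕ} {G H : (Fin 4 → ℝ) → Matrix (Fin n) (Fin n) ℂ}
    (hG : IsSmoothMat G) (hH : IsSmoothMat H) (huG : ∀ p, IsUnit (G p))
    (huH : ∀ p, IsUnit (H p)) {A : Fin 4 → (Fin 4 → ℝ) → Matrix (Fin n) (Fin n) ℂ}
    {u v : Fin 4} (hAu : A u = pureGauge G u) (hAv : A v = pureGauge H v) (p : Fin 4 → ℝ) :
    pd v (pureGauge (fun q => G q * (H q)⁻¹) u) p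
      = -(H p * fieldStrength A u v p * (H p)⁻¹) := by
  have hX := (hG.pureGauge huG u).sub (hH.pureGauge huH u)
  have hflat := fieldStrength_pureGauge hH huH u v p
  rw [funext (pureGauge_mul_inv hG hH huG huH u), pd_conj hH hX huH,
    pd_sub (hG.pureGauge huG u) (hH.pureGauge huH u), ← neg_mul, ← mul_neg]
  congr 2
  rw [← sub_eq_zero]
  simp only [fieldStrength, hAu, hAv] at hflat ⊢
  rw [← hflat]
  noncomm_ring

/-- For gauge potentials in the `G`, `Ḡ` gauge, `F_{yz} = F_{ȳz̄} = 0` holds identically and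
the remaining SDYM equation `F_{yȳ} + F_{zz̄} = 0` is equivalent to Yang's equation for
`J = G Ḡ⁻¹`. -/
theorem stmt1 {n : ℕ} (hn : 1 ≤ n)
    (G Gbar : (Fin 4 → ℝ) → Matrix (Fin n) (Fin n) ℂ)
    (hG : IsSmoothMat G) (hGbar : IsSmoothMat Gbar)
    (hGinv : ∀ p, IsUnit (G p)) (hGbarinv : ∀ p, IsUnit (Gbar p))
    (A : Fin 4 → (Fin 4 → ℝ) → Matrix (Fin n) (Fin n) ℂ)
    (hA0 : ∀ p, A 0 p = (G p)⁻¹ * pd 0 G p)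
    (hA1 : ∀ p, A 1 p = (G p)⁻¹ * pd 1 G p)
    (hA2 : ∀ p, A 2 p = (Gbar p)⁻¹ * pd 2 Gbar p)
    (hA3 : ∀ p, A 3 p = (Gbar p)⁻¹ * pd 3 Gbar p)
    (J : (Fin 4 → ℝ) → Matrix (Fin n) (Fin n) ℂ)
    (hJ : ∀ p, J p = G p * (Gbar p)⁻¹) :
    (∀ p, fieldStrength A 0 1 p = 0 ∧ fieldStrength A 2 3 p = 0)
    ∧ (∀ p, pd 2 (fun q => (J q)⁻¹ * pd 0 J q) p + pd 3 (fun q => (J q)⁻¹ * pd 1 J q) p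
        = - (Gbar p * (fieldStrength A 0 2 p + fieldStrength A 1 3 p) * (Gbar p)⁻¹))
    ∧ ((∀ p, fieldStrength A 0 2 p + fieldStrength A 1 3 p = 0)
        ↔ (∀ p, pd 2 (fun q => (J q)⁻¹ * pd 0 J q) p
            + pd 3 (fun q => (J q)⁻¹ * pd 1 J q) p = 0)) := by
  have h0 : A 0 = pureGauge G 0 := funext hA0
  have h1 : A 1 = pureGauge G 1 := funext hA1
  have h2 : A 2 = pureGauge Gbar 2 := funext hA2
  have h3 : A 3 = pureGauge Gbar 3 := funext hA3
  obtain rfl : J = fun q => G q * (Gbar q)⁻¹ := funext hJ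
  have key : ∀ p, pd 2 (pureGauge (fun q => G q * (Gbar q)⁻¹) 0) p
      + pd 3 (pureGauge (fun q => G q * (Gbar q)⁻¹) 1) p
        = - (Gbar p * (fieldStrength A 0 2 p + fieldStrength A 1 3 p) * (Gbar p)⁻¹) := by
    intro p
    rw [pd_pureGauge_mul_inv hG hGbar hGinv hGbarinv h0 h2,
      pd_pureGauge_mul_inv hG hGbar hGinv hGbarinv h1 h3]
    noncomm_ring
  refine ⟨fun p => ⟨?_, ?_⟩, key, forall_congr' fun p => ?_⟩
  · rw [← fieldStrength_pureGauge hG hGinv 0 1 p]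
    simp only [fieldStrength, h0, h1]
  · rw [← fieldStrength_pureGauge hGbar hGbarinv 2 3 p]
    simp only [fieldStrength, h2, h3]
  · change _ ↔ pd 2 (pureGauge (fun q => G q * (Gbar q)⁻¹) 0) p
      + pd 3 (pureGauge (fun q => G q * (Gbar q)⁻¹) 1) p = 0
    have hinv : IsUnit (Gbar p)⁻¹ := Matrix.isUnit_nonsing_inv_iff.2 (hGbarinv p)
    rw [key p, neg_eq_zero, hinv.mul_left_eq_zero, (hGbarinv p).mul_right_eq_zero]
end

section
/- Let F : ℝ³ → ℝ and G : ℝ³ → ℂ be smooth functions of (X, Y, T) with F(p) > 0 for all p. Assume the Hirota bilinear equations i·(D_T G·F) + (D_X D_Y G·F) = 0 and D_X² F·F = 2·G·conj(G) hold at every point. Then u := G/F and v := ∂_X∂_Y(log F) satisfy i·∂_T u + ∂_X∂_Y u + 2·u·v = 0 and ∂_X v = ∂_Y(|u|²) at every point; that is, u solves the (2+1)-dimensional nonlinear Schrödinger equation i u_T + u_{XY} + 2u·∫^X (|u|²)_Y dX = 0 with the nonlocal term realized by the potential v. -/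
/-- Partial derivative of a complex-valued function on `ℝ³` with respect to
coordinate `u`. Coordinates: `0 = X`, `1 = Y`, `2 = T`. -/
noncomputable def pds (u : Fin 3) (f : (Fin 3 → ℝ) → ℂ) (p : Fin 3 → ℝ) : ℂ :=
  deriv (fun t => f (Function.update p u t)) (p u)

theorem pds_eq_fderiv {f : (Fin 3 → ℝ) → ℂ} (hf : Differentiable ℝ f) (a : Fin 3) :
    pds a f = fun p => fderiv ℝ f p (Pi.single a 1) := by
  funext p
  have h := (hf (Function.update p a (p a))).hasFDerivAt.comp_hasDerivAt (p a)
    (hasDerivAt_update p a (p a))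
  rw [Function.update_eq_self] at h
  exact h.deriv

theorem ContDiff.pds {f : (Fin 3 → ℝ) → ℂ} (hf : ContDiff ℝ (⊤ : ℕ∞) f) (a : Fin 3) :
    ContDiff ℝ (⊤ : ℕ∞) (pds a f) := by
  rw [pds_eq_fderiv (hf.differentiable (by simp)) a]
  exact (hf.fderiv_right (m := (⊤ : ℕ∞)) (by simp)).clm_apply contDiff_const

theorem hasDerivAt_pds {f : (Fin 3 → ℝ) → ℂ} (hf : Differentiable ℝ f) (a : Fin 3)
    (p : Fin 3 → ℝ) :
    HasDerivAt (fun t => f (Function.update p a t)) (pds a f p) (p a) :=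
  (DifferentiableAt.comp (p a) (hf _)
    (hasDerivAt_update p a (p a)).differentiableAt).hasDerivAt

theorem pds_comm {f : (Fin 3 → ℝ) → ℂ} (hf : ContDiff ℝ (⊤ : ℕ∞) f) (a b : Fin 3) :
    pds a (pds b f) = pds b (pds a f) := by
  have hd : Differentiable ℝ f := hf.differentiable (by simp)
  have hd2 : Differentiable ℝ (fderiv ℝ f) :=
    (hf.fderiv_right (m := (⊤ : ℕ∞)) (by simp)).differentiable (by simp)
  have key (a b : Fin 3) (p : Fin 3 → ℝ) :
      pds a (pds b f) p = fderiv ℝ (fderiv ℝ f) p (Pi.single a 1) (Pi.single b 1) := by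
    rw [pds_eq_fderiv ((hf.pds b).differentiable (by simp)) a, pds_eq_fderiv hd b]
    simp [fderiv_clm_apply (hd2 p) (differentiableAt_const _)]
  funext p
  rw [key, key]
  have h2 : minSmoothness ℝ 2 ≤ ((⊤ : ℕ∞) : WithTop ℕ∞) := by
    rw [minSmoothness_of_isRCLikeNormedField]
    exact WithTop.coe_le_coe.2 (le_top : (2 : ℕ∞) ≤ ⊤)
  exact hf.contDiffAt.isSymmSndFDerivAt h2 _ _

theorem pds_mul {f g : (Fin 3 → ℝ) → ℂ} (hf : Differentiable ℝ f) (hg : Differentiable ℝ g)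
    (a : Fin 3) :
    pds a (fun q => f q * g q) = fun p => pds a f p * g p + f p * pds a g p := by
  funext p
  have h := ((hasDerivAt_pds hf a p).mul (hasDerivAt_pds hg a p)).deriv
  rw [Function.update_eq_self] at h
  exact h

theorem pds_sub {f g : (Fin 3 → ℝ) → ℂ} (hf : Differentiable ℝ f) (hg : Differentiable ℝ g)
    (a : Fin 3) :
    pds a (fun q => f q - g q) = fun p => pds a f p - pds a g p := by
  funext p
  exact ((hasDerivAt_pds hf a p).sub (hasDerivAt_pds hg a p)).deriv

theorem pds_div {f g : (Fin 3 → ℝ) → ℂ} (hf : Differentiable ℝ f) (hg : Differentiable ℝ g)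
    (hg0 : ∀ p, g p ≠ 0) (a : Fin 3) :
    pds a (fun q => f q / g q) = fun p => (pds a f p * g p - f p * pds a g p) / g p ^ 2 := by
  funext p
  have h := ((hasDerivAt_pds hf a p).div (hasDerivAt_pds hg a p) (hg0 _)).deriv
  rw [Function.update_eq_self] at h
  exact h

theorem pds_ofReal_log {F : (Fin 3 → ℝ) → ℝ} (hF : Differentiable ℝ F) (hFpos : ∀ p, 0 < F p)
    (a : Fin 3) :
    pds a (fun q => (Real.log (F q) : ℂ)) =
      fun p => pds a (fun q => (F q : ℂ)) p / (F p : ℂ) := by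
  funext p
  have hd : HasDerivAt (fun t => F (Function.update p a t))
      (deriv (fun t => F (Function.update p a t)) (p a)) (p a) :=
    (DifferentiableAt.comp (p a) (hF _)
      (hasDerivAt_update p a (p a)).differentiableAt).hasDerivAt
  have hlog := (hd.log (hFpos _).ne').ofReal_comp.deriv
  have hof := hd.ofReal_comp.deriv
  rw [pds, pds, hlog, hof]
  simp

/-- Strachan's bilinearization: the Hirota bilinear equations
`i D_T G·F + D_X D_Y G·F = 0` and `D_X² F·F = 2 G Ḡ` imply that `u = G/F` and
`v = ∂_X ∂_Y log F` solve the (2+1)-dimensional NLS system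
`i u_T + u_{XY} + 2uv = 0`, `v_X = (|u|²)_Y`. -/
theorem stmt6 (F : (Fin 3 → ℝ) → ℝ) (G : (Fin 3 → ℝ) → ℂ)
    (hF : ContDiff ℝ (⊤ : ℕ∞) F) (hG : ContDiff ℝ (⊤ : ℕ∞) G) (hFpos : ∀ p, 0 < F p)
    (Fc : (Fin 3 → ℝ) → ℂ) (hFc : ∀ p, Fc p = (F p : ℂ))
    (h1 : ∀ p, Complex.I * (pds 2 G p * Fc p - G p * pds 2 Fc p)
        + (pds 0 (pds 1 G) p * Fc p - pds 0 G p * pds 1 Fc p - pds 1 G p * pds 0 Fc p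
            + G p * pds 0 (pds 1 Fc) p) = 0)
    (h2 : ∀ p, 2 * (pds 0 (pds 0 Fc) p * Fc p - (pds 0 Fc p) ^ 2)
        = 2 * (G p * (starRingEnd ℂ) (G p)))
    (u v : (Fin 3 → ℝ) → ℂ)
    (hu : ∀ p, u p = G p / Fc p)
    (hv : ∀ p, v p = pds 0 (pds 1 (fun q => (Real.log (F q) : ℂ))) p) :
    ∀ p, (Complex.I * pds 2 u p + pds 0 (pds 1 u) p + 2 * u p * v p = 0)
      ∧ pds 0 v p = pds 1 (fun q => u q * (starRingEnd ℂ) (u q)) p := by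
  obtain rfl : Fc = fun q => (F q : ℂ) := funext hFc
  obtain rfl : u = fun q => G q / (F q : ℂ) := funext hu
  obtain rfl : v = pds 0 (pds 1 (fun q => (Real.log (F q) : ℂ))) := funext hv
  have hF0 (p) : (F p : ℂ) ≠ 0 := by exact_mod_cast (hFpos p).ne'
  have hFd : Differentiable ℝ F := hF.differentiable (by simp)
  have hC : ContDiff ℝ (⊤ : ℕ∞) (fun q => (F q : ℂ)) :=
    Complex.ofRealCLM.contDiff.comp hF
  have hL : ContDiff ℝ (⊤ : ℕ∞) (fun q => (Real.log (F q) : ℂ)) :=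
    Complex.ofRealCLM.contDiff.comp (hF.log fun p => (hFpos p).ne')
  have diff {f : (Fin 3 → ℝ) → ℂ} (hf : ContDiff ℝ (⊤ : ℕ∞) f) : Differentiable ℝ f :=
    hf.differentiable (by simp)
  have hlog (a b : Fin 3) : pds a (pds b (fun q => (Real.log (F q) : ℂ))) = fun p =>
      (pds a (pds b fun q => (F q : ℂ)) p * (F p : ℂ)
        - pds b (fun q => (F q : ℂ)) p * pds a (fun q => (F q : ℂ)) p) / (F p : ℂ) ^ 2 := by
    rw [pds_ofReal_log hFd hFpos, pds_div (diff (hC.pds b)) (diff hC) hF0]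
  intro p
  constructor
  · have hsq : Differentiable ℝ fun q => (F q : ℂ) ^ 2 := (diff hC).pow 2
    have hpow (a : Fin 3) : pds a (fun q => (F q : ℂ) ^ 2) p =
        2 * (F p : ℂ) * pds a (fun q => (F q : ℂ)) p := by
      simp only [pow_two]
      rw [pds_mul (diff hC) (diff hC)]
      ring
    have hGx : Differentiable ℝ fun q => pds 1 G q * (F q : ℂ) := (diff (hG.pds 1)).mul (diff hC)
    have hFx : Differentiable ℝ fun q => G q * pds 1 (fun q => (F q : ℂ)) q := (diff hG).mul (diff (hC.pds 1))
    rw [hlog, pds_div (diff hG) (diff hC) hF0, pds_div (diff hG) (diff hC) hF0,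
      pds_div (hGx.fun_sub hFx) hsq fun q => pow_ne_zero 2 (hF0 q),
      pds_sub hGx hFx, pds_mul (diff (hG.pds 1)) (diff hC),
      pds_mul (diff hG) (diff (hC.pds 1))]
    have h := h1 p
    have h0 := hF0 p
    simp only [hpow] at h ⊢
    field_simp
    linear_combination (F p : ℂ) * h
  · have hmod : pds 0 (pds 0 (fun q => (Real.log (F q) : ℂ))) =
        fun q => G q / (F q : ℂ) * (starRingEnd ℂ) (G q / (F q : ℂ)) := by
      rw [hlog]
      funext q
      have h := h2 q
      have h0 := hF0 q
      simp only [map_div₀, Complex.conj_ofReal] at h ⊢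
      field_simp
      linear_combination h / 2
    rw [← hmod, pds_comm hL 0 1, pds_comm (hL.pds 0) 0 1]
end

section
/- Let N ≥ 1 and let ξ₀, …, ξ_N ∈ Matrix (Fin 2) (Fin 2N) ℂ be such that the 2N × 2N matrix obtained by stacking ξ_{N−1}, …, ξ₁, ξ₀ vertically is invertible, and let w₁, …, w_N ∈ Matrix (Fin 2) (Fin 2) ℂ be the unique matrices with ξ_N + Σ_{m=1}^{N} w_m·ξ_{N−m} = 0. Suppose there exist invertible matrices P₁ ∈ Matrix (Fin 2) (Fin 2) ℂ and P₂ ∈ Matrix (Fin 2N) (Fin 2N) ℂ such that the entrywise complex conjugate of ξ_j equals P₁·ξ_j·P₂ for every j = 0, …, N. Then for every m = 1, …, N the entrywise complex conjugate of w_m equals P₁·w_m·P₁⁻¹. -/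
/-- The `2N × 2N` matrix obtained by stacking the `2 × 2N` blocks
`ξ_{N−1}, ξ_{N−2}, …, ξ₁, ξ₀` vertically (in this order): rows `2k, 2k+1` are the two
rows of `ξ_{N−1−k}`. -/
def stackMat (N : ℕ) (ξ : ℕ → Matrix (Fin 2) (Fin (2 * N)) ℂ) :
    Matrix (Fin (2 * N)) (Fin (2 * N)) ℂ :=
  Matrix.of fun i j => ξ (N - 1 - (i : ℕ) / 2) ⟨(i : ℕ) % 2, Nat.mod_lt _ (by norm_num)⟩ j

/-- The blocks of an invertible stacked matrix are linearly independent over `2 × 2` left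
coefficients. -/
theorem eq_zero_of_sum_mul_eq_zero {N : ℕ} {ξ : ℕ → Matrix (Fin 2) (Fin (2 * N)) ℂ}
    (hinv : IsUnit (stackMat N ξ)) {u : Fin N → Matrix (Fin 2) (Fin 2) ℂ}
    (hu : ∑ m : Fin N, u m * ξ (N - 1 - (m : ℕ)) = 0) : u = 0 := by
  let e : Fin N × Fin 2 ≃ Fin (2 * N) :=
    finProdFinEquiv.trans (finCongr (Nat.mul_comm N 2))
  have he : ∀ p, ((e p : Fin (2 * N)) : ℕ) = (p.2 : ℕ) + 2 * (p.1 : ℕ) := fun p => rfl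
  have hrow : ∀ a : Fin 2, (fun i => u (e.symm i).1 a (e.symm i).2) = 0 := by
    intro a
    apply Matrix.vecMul_injective_of_isUnit hinv
    refine Eq.trans ?_ (Matrix.zero_vecMul _).symm
    funext j
    have h := congrFun (congrFun hu a) j
    simp only [Matrix.sum_apply, Matrix.mul_apply, Matrix.zero_apply] at h
    rw [Pi.zero_apply, ← h, ← Fintype.sum_prod_type']
    simp only [Matrix.vecMul, dotProduct]
    rw [← e.sum_comp]
    refine Finset.sum_congr rfl fun p _ => ?_
    have hdiv : ((e p : Fin (2 * N)) : ℕ) / 2 = p.1 := by rw [he]; omega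
    have hmod : ((e p : Fin (2 * N)) : ℕ) % 2 = p.2 := by rw [he]; omega
    simp [stackMat, hdiv, hmod]
  ext m a b
  simpa using congrFun (hrow a) (e (m, b))

/-- Reality proposition for the double-Wronskian solutions: if the data satisfies
`conj ξ_j = P₁ ξ_j P₂`, the unique solution `w` of the residue condition satisfies
`conj w_m = P₁ w_m P₁⁻¹`. -/
theorem stmt8 (N : ℕ) (hN : 1 ≤ N) (ξ : ℕ → Matrix (Fin 2) (Fin (2 * N)) ℂ)
    (hinv : IsUnit (stackMat N ξ))
    (w : Fin N → Matrix (Fin 2) (Fin 2) ℂ)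
    (hw : ξ N + ∑ m : Fin N, w m * ξ (N - 1 - (m : ℕ)) = 0)
    (P1 : Matrix (Fin 2) (Fin 2) ℂ) (P2 : Matrix (Fin (2 * N)) (Fin (2 * N)) ℂ)
    (hP1 : IsUnit P1) (hP2 : IsUnit P2)
    (hconj : ∀ j ≤ N, (ξ j).map (starRingEnd ℂ) = P1 * ξ j * P2) :
    ∀ m : Fin N, (w m).map (starRingEnd ℂ) = P1 * w m * P1⁻¹ := by
  have hd1 : IsUnit P1.det := (Matrix.isUnit_iff_isUnit_det P1).1 hP1
  have hd2 : IsUnit P2.det := (Matrix.isUnit_iff_isUnit_det P2).1 hP2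
  have hcw : P1 * ξ N * P2
      + ∑ m : Fin N, (w m).map (starRingEnd ℂ) * (P1 * ξ (N - 1 - (m : ℕ)) * P2) = 0 := by
    have h := congrArg (starRingEnd ℂ).toAddMonoidHom.mapMatrix hw
    rw [map_add, map_sum, map_zero] at h
    rw [← hconj N le_rfl, ← h]
    refine congrArg₂ _ rfl (Finset.sum_congr rfl fun m _ => ?_)
    rw [← hconj _ (by omega)]
    exact Matrix.map_mul.symm
  have hz : ξ N
      + ∑ m : Fin N, P1⁻¹ * (w m).map (starRingEnd ℂ) * P1 * ξ (N - 1 - (m : ℕ)) = 0 := by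
    have h := congrArg (fun X => P1⁻¹ * X * P2⁻¹) hcw
    simpa only [Matrix.mul_add, Matrix.add_mul, Matrix.mul_sum, Matrix.sum_mul, Matrix.mul_zero,
      Matrix.zero_mul, Matrix.mul_assoc, Matrix.nonsing_inv_mul_cancel_left _ _ hd1,
      Matrix.mul_nonsing_inv _ hd2, Matrix.mul_one] using h
  have hu := eq_zero_of_sum_mul_eq_zero hinv
    (u := fun m => P1⁻¹ * (w m).map (starRingEnd ℂ) * P1 - w m) (by
      simp only [Matrix.sub_mul, Finset.sum_sub_distrib]
      rw [sub_eq_zero]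
      exact add_left_cancel (hz.trans hw.symm))
  intro m
  have hm : P1⁻¹ * (w m).map (starRingEnd ℂ) * P1 = w m := sub_eq_zero.1 (congrFun hu m)
  conv_rhs => rw [← hm]
  simp only [Matrix.mul_assoc, Matrix.mul_nonsing_inv_cancel_left _ _ hd1,
    Matrix.mul_nonsing_inv _ hd1, Matrix.mul_one]
end

section
/- Fix integers N ≥ 1 and n ≥ 1, set Q := diagonal(1, −1) ∈ Matrix (Fin 2) (Fin 2) ℂ, and let γ, α ∈ Matrix (Fin 2N) (Fin 2N) ℂ. Let ξ_j : ℝ → Matrix (Fin 2) (Fin 2N) ℂ (j ∈ ℕ) be smooth functions of t satisfying ξ_{j+1}(t) = ξ_j(t)·γ and ξ_j'(t) = Q·ξ_{j+n}(t) + ξ_j(t)·α for all j ≥ 0 and all t. Assume that for every t the 2N × 2N matrix obtained by stacking ξ_{N−1}(t), …, ξ₁(t), ξ₀(t) vertically is invertible, and let w₁(t), …, w_N(t) be the unique 2×2 matrices with ξ_N(t) + Σ_{m=1}^{N} w_m(t)·ξ_{N−m}(t) = 0 (these are smooth in t). Set W(λ, t) := I·λ^N + Σ_{m=1}^{N} w_m(t)·λ^{N−m}.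 Then there exist smooth matrix functions b₀, …, b_n : ℝ → Matrix (Fin 2) (Fin 2) ℂ such that for all λ ∈ ℂ and all t, ∂_t W(λ, t) + λⁿ·W(λ, t)·Q = (Σ_{k=0}^{n} b_k(t)·λ^k)·W(λ, t). -/
/-- Entrywise derivative of a matrix-valued function of one real variable. -/
noncomputable def mderiv {m n : ℕ} (f : ℝ → Matrix (Fin m) (Fin n) ℂ) (t : ℝ) :
    Matrix (Fin m) (Fin n) ℂ :=
  Matrix.of fun i j => deriv (fun s => f s i j) t

open Polynomial

/-- Entrywise differentiability of a matrix-valued function, with the given derivative. -/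
def HasMDerivAt {m n : ℕ} (f : ℝ → Matrix (Fin m) (Fin n) ℂ) (f' : Matrix (Fin m) (Fin n) ℂ)
    (t : ℝ) : Prop :=
  ∀ i j, HasDerivAt (fun s => f s i j) (f' i j) t

namespace HasMDerivAt

variable {l m n : ℕ} {t : ℝ}

theorem mderiv_eq {f : ℝ → Matrix (Fin m) (Fin n) ℂ} {f' : Matrix (Fin m) (Fin n) ℂ}
    (h : HasMDerivAt f f' t) : mderiv f t = f' := by
  ext i j
  exact (h i j).deriv

theorem of_contDiff {f : ℝ → Matrix (Fin m) (Fin n) ℂ}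
    (h : ∀ i j, ContDiff ℝ (⊤ : ℕ∞) fun s => f s i j) : HasMDerivAt f (mderiv f t) t :=
  fun i j => ((h i j).differentiable (by simp) t).hasDerivAt

theorem const (c : Matrix (Fin m) (Fin n) ℂ) : HasMDerivAt (fun _ => c) 0 t :=
  fun i j => hasDerivAt_const t (c i j)

theorem add {f g : ℝ → Matrix (Fin m) (Fin n) ℂ} {f' g' : Matrix (Fin m) (Fin n) ℂ}
    (hf : HasMDerivAt f f' t) (hg : HasMDerivAt g g' t) :
    HasMDerivAt (fun s => f s + g s) (f' + g') t :=
  fun i j => (hf i j).add (hg i j)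

theorem sum {ι : Type*} (u : Finset ι) {f : ι → ℝ → Matrix (Fin m) (Fin n) ℂ}
    {f' : ι → Matrix (Fin m) (Fin n) ℂ} (hf : ∀ k ∈ u, HasMDerivAt (f k) (f' k) t) :
    HasMDerivAt (fun s => ∑ k ∈ u, f k s) (∑ k ∈ u, f' k) t := by
  intro i j
  simp only [Matrix.sum_apply]
  exact HasDerivAt.fun_sum fun k hk => hf k hk i j

theorem const_smul (c : ℂ) {f : ℝ → Matrix (Fin m) (Fin n) ℂ} {f' : Matrix (Fin m) (Fin n) ℂ}
    (hf : HasMDerivAt f f' t) : HasMDerivAt (fun s => c • f s) (c • f') t :=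
  fun i j => (hf i j).const_mul c

theorem mul {f : ℝ → Matrix (Fin l) (Fin m) ℂ} {g : ℝ → Matrix (Fin m) (Fin n) ℂ}
    {f' : Matrix (Fin l) (Fin m) ℂ} {g' : Matrix (Fin m) (Fin n) ℂ}
    (hf : HasMDerivAt f f' t) (hg : HasMDerivAt g g' t) :
    HasMDerivAt (fun s => f s * g s) (f' * g t + f t * g') t := by
  intro i j
  simp only [Matrix.add_apply, Matrix.mul_apply, ← Finset.sum_add_distrib]
  exact HasDerivAt.fun_sum fun k _ => (hf i k).mul (hg k j)

end HasMDerivAt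

theorem contDiff_mderiv_apply {m n : ℕ} {f : ℝ → Matrix (Fin m) (Fin n) ℂ}
    (h : ∀ i j, ContDiff ℝ (⊤ : ℕ∞) fun s => f s i j) (i : Fin m) (j : Fin n) :
    ContDiff ℝ (⊤ : ℕ∞) fun s => mderiv f s i j :=
  (contDiff_infty_iff_deriv.1 (h i j)).2

theorem contDiff_matrix_det {p : ℕ} {A : ℝ → Matrix (Fin p) (Fin p) ℂ}
    (h : ∀ i j, ContDiff ℝ (⊤ : ℕ∞) fun s => A s i j) :
    ContDiff ℝ (⊤ : ℕ∞) fun s => (A s).det := by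
  simp only [Matrix.det_apply]
  exact ContDiff.sum fun σ _ => (contDiff_prod fun i _ => h _ _).const_smul _

theorem contDiff_matrix_inv_apply {p : ℕ} {A : ℝ → Matrix (Fin p) (Fin p) ℂ}
    (h : ∀ i j, ContDiff ℝ (⊤ : ℕ∞) fun s => A s i j) (hA : ∀ s, IsUnit (A s)) (i j : Fin p) :
    ContDiff ℝ (⊤ : ℕ∞) fun s => (A s)⁻¹ i j := by
  simp only [Matrix.inv_def, Matrix.smul_apply, Ring.inverse_eq_inv', smul_eq_mul]
  refine ContDiff.mul (ContDiff.inv (contDiff_matrix_det h) fun s => ?_) ?_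
  · exact ((Matrix.isUnit_iff_isUnit_det _).1 (hA s)).ne_zero
  · simp only [Matrix.adjugate_apply]
    refine contDiff_matrix_det fun a b => ?_
    by_cases ha : a = j
    · subst ha
      simpa using contDiff_const
    · simpa [Matrix.updateRow_ne ha] using h a b

/-- The `2 × 2N` matrix formed by the `2 × 2` blocks `c 0, …, c (N - 1)` side by side. -/
def blockRow {N : ℕ} (c : Fin N → Matrix (Fin 2) (Fin 2) ℂ) : Matrix (Fin 2) (Fin (2 * N)) ℂ :=
  Matrix.of fun a i => c ⟨(i : ℕ) / 2, by omega⟩ a ⟨(i : ℕ) % 2, Nat.mod_lt _ (by norm_num)⟩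

theorem blockRow_apply {N : ℕ} (c : Fin N → Matrix (Fin 2) (Fin 2) ℂ) (m : Fin N)
    (a b : Fin 2) : blockRow c a ⟨2 * m + b, by omega⟩ = c m a b := by
  have h1 : (⟨(2 * (m : ℕ) + b) / 2, by omega⟩ : Fin N) = m := by ext; simp; omega
  have h2 : (⟨(2 * (m : ℕ) + b) % 2, by omega⟩ : Fin 2) = b := by ext; simp; omega
  simp only [blockRow, Matrix.of_apply, h1, h2]

theorem blockRow_mul_stackMat {N : ℕ} (c : Fin N → Matrix (Fin 2) (Fin 2) ℂ)
    (ξ : ℕ → Matrix (Fin 2) (Fin (2 * N)) ℂ) :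
    blockRow c * stackMat N ξ = ∑ m : Fin N, c m * ξ (N - 1 - (m : ℕ)) := by
  ext a j
  simp only [Matrix.mul_apply, Matrix.sum_apply]
  rw [← Fintype.sum_prod_type' fun (m : Fin N) (b : Fin 2) => c m a b * ξ (N - 1 - m) b j]
  symm
  refine Fintype.sum_equiv (finProdFinEquiv.trans (finCongr (Nat.mul_comm N 2))) _ _ ?_
  rintro ⟨m, b⟩
  have e : (finProdFinEquiv.trans (finCongr (Nat.mul_comm N 2))) (m, b)
      = ⟨2 * m + b, by omega⟩ := by
    ext; simp [add_comm]
  have h1 : (2 * (m : ℕ) + b) / 2 = m := by omega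
  have h2 : (⟨(2 * (m : ℕ) + b) % 2, by omega⟩ : Fin 2) = b := by ext; simp; omega
  rw [e, blockRow_apply]
  simp only [stackMat, Matrix.of_apply, h1, h2]

/-- Division with the quotient on the left, over a possibly noncommutative ring. -/
theorem Polynomial.exists_eq_mul_monic_add {R : Type*} [Ring R] {W : R[X]} {N : ℕ}
    (hN : W.coeff N = 1) (hW : W.degree < (N + 1 : ℕ)) (n : ℕ) (p : R[X])
    (hp : p.degree < (N + n : ℕ)) :
    ∃ B S : R[X], B.degree < n ∧ S.degree < N ∧ p = B * W + S := by
  induction n generalizing p with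
  | zero => exact ⟨0, p, by simp, by simpa using hp, by simp⟩
  | succ n ih =>
    rw [degree_lt_iff_coeff_zero] at hW hp
    obtain ⟨B, S, hB, hS, h⟩ := ih (p - monomial n (p.coeff (N + n)) * W) (by
      rw [degree_lt_iff_coeff_zero]
      intro k hk
      obtain ⟨d, rfl⟩ : ∃ d, k = d + n := ⟨k - n, by omega⟩
      rw [coeff_sub, coeff_monomial_mul]
      rcases eq_or_lt_of_le (show N ≤ d by omega) with rfl | hd
      · simp [hN]
      · rw [hW d (by omega), hp _ (by omega)]
        simp)
    refine ⟨B + monomial n (p.coeff (N + n)), S, ?_, hS, ?_⟩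
    · refine (degree_add_le _ _).trans_lt (max_lt (hB.trans ?_) ((degree_monomial_le _ _).trans_lt ?_))
      all_goals exact_mod_cast Nat.lt_succ_self n
    · rw [add_mul, add_right_comm, ← h, sub_add_cancel]

/-- The ring of smooth functions with values in `2 × 2` matrices. -/
def smoothMat : Subring (ℝ → Matrix (Fin 2) (Fin 2) ℂ) where
  carrier := {f | ∀ a b, ContDiff ℝ (⊤ : ℕ∞) fun t => f t a b}
  mul_mem' hf hg a b := by
    simp only [Pi.mul_apply, Matrix.mul_apply]
    exact ContDiff.sum fun k _ => (hf a k).mul (hg k b)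
  one_mem' a b := contDiff_const
  add_mem' hf hg a b := (hf a b).add (hg a b)
  zero_mem' a b := contDiff_const
  neg_mem' hf a b := (hf a b).neg

/-- Evaluation of the coefficients at `t` and of the variable at `lam`. -/
noncomputable def evalAt (lam : ℂ) (t : ℝ) : smoothMat[X] →+* Matrix (Fin 2) (Fin 2) ℂ :=
  eval₂RingHom' ((Pi.evalRingHom _ t).comp smoothMat.subtype) (lam • 1) fun a => by
    simp [Commute, SemiconjBy]

theorem evalAt_monomial (lam : ℂ) (t : ℝ) (k : ℕ) (a : smoothMat) :
    evalAt lam t (monomial k a) = lam ^ k • a.1 t := by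
  change eval₂ _ _ (monomial k a) = _
  simp [eval₂_monomial, _root_.smul_pow]

/-- The substitution `∑ pₖ λᵏ ↦ ∑ pₖ(t) ξₖ`. -/
noncomputable def coeffSubst {q : ℕ} (ξ : ℕ → Matrix (Fin 2) (Fin q) ℂ) (t : ℝ) :
    smoothMat[X] →+ Matrix (Fin 2) (Fin q) ℂ where
  toFun p := p.sum fun k a => a.1 t * ξ k
  map_zero' := by simp
  map_add' p r := sum_add_index p r _ (fun k => by simp) fun k a b => by simp [Matrix.add_mul]

theorem coeffSubst_monomial {q : ℕ} (ξ : ℕ → Matrix (Fin 2) (Fin q) ℂ) (t : ℝ) (k : ℕ)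
    (a : smoothMat) : coeffSubst ξ t (monomial k a) = a.1 t * ξ k :=
  sum_monomial_index a (fun k (a : smoothMat) => a.1 t * ξ k) (by simp)

theorem coeffSubst_mul_eq_zero {q : ℕ} {ξ : ℕ → Matrix (Fin 2) (Fin q) ℂ}
    {γ : Matrix (Fin q) (Fin q) ℂ} (hξ : ∀ j, ξ (j + 1) = ξ j * γ) {t : ℝ} {p : smoothMat[X]}
    (hp : coeffSubst ξ t p = 0) (r : smoothMat[X]) : coeffSubst ξ t (r * p) = 0 := by
  have hpow : ∀ k j, ξ (k + j) = ξ j * γ ^ k := by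
    intro k j
    induction k with
    | zero => simp
    | succ k ih => rw [pow_succ, ← Matrix.mul_assoc, ← ih, ← hξ]; congr 1; omega
  have key : ∀ (k : ℕ) (a : smoothMat) (s : smoothMat[X]),
      coeffSubst ξ t (monomial k a * s) = a.1 t * coeffSubst ξ t s * γ ^ k := by
    intro k a s
    induction s using Polynomial.induction_on' with
    | add s u hs hu => simp [mul_add, hs, hu, Matrix.mul_add, Matrix.add_mul]
    | monomial j b =>
      rw [monomial_mul_monomial, coeffSubst_monomial, coeffSubst_monomial, hpow]
      simp [Matrix.mul_assoc]
  induction r using Polynomial.induction_on' with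
  | add s u hs hu => rw [add_mul, map_add, hs, hu, add_zero]
  | monomial k a => rw [key, hp]; simp

theorem coeffSubst_eq_sum_fin {N : ℕ} (ξ : ℕ → Matrix (Fin 2) (Fin (2 * N)) ℂ) (t : ℝ)
    {p : smoothMat[X]} (hp : p.degree < N) :
    coeffSubst ξ t p = ∑ m : Fin N, (p.coeff (N - 1 - m)).1 t * ξ (N - 1 - (m : ℕ)) := by
  have h : coeffSubst ξ t p = ∑ k ∈ Finset.range N, (p.coeff k).1 t * ξ k := by
    rw [degree_lt_iff_coeff_zero] at hp
    refine sum_eq_of_subset (fun k (a : smoothMat) => a.1 t * ξ k) (fun k => by simp) fun k hk => ?_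
    by_contra hk'
    exact (mem_support_iff.1 hk) (hp k (by simpa using hk'))
  rw [h, ← Finset.sum_range_reflect, Finset.sum_range]

theorem eq_zero_of_coeffSubst_eq_zero {N : ℕ} {ξ : ℕ → ℝ → Matrix (Fin 2) (Fin (2 * N)) ℂ}
    (hinv : ∀ t : ℝ, IsUnit (stackMat N (fun j => ξ j t))) {p : smoothMat[X]}
    (hp : p.degree < N) (h : ∀ t, coeffSubst (fun j => ξ j t) t p = 0) : p = 0 := by
  ext1 k
  by_cases hk : k < N
  · apply Subtype.ext
    funext t
    have h0 := h t
    rw [coeffSubst_eq_sum_fin _ t hp, ← blockRow_mul_stackMat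
      (fun m : Fin N => (p.coeff (N - 1 - m)).1 t) (fun j => ξ j t)] at h0
    have h1 := congrArg (· * (stackMat N fun j => ξ j t)⁻¹) h0
    simp only [Matrix.zero_mul] at h1
    rw [Matrix.mul_nonsing_inv_cancel_right _ _
      ((Matrix.isUnit_iff_isUnit_det _).1 (hinv t))] at h1
    ext a b
    have h2 := blockRow_apply (fun m : Fin N => (p.coeff (N - 1 - m)).1 t) ⟨N - 1 - k, by omega⟩ a b
    rw [h1] at h2
    have h3 : N - 1 - (N - 1 - k) = k := by omega
    simpa [h3] using h2.symm
  · rw [degree_lt_iff_coeff_zero] at hp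
    simpa using hp k (by omega)

theorem contDiff_of_mul_stackMat {N : ℕ} {ξ : ℕ → ℝ → Matrix (Fin 2) (Fin (2 * N)) ℂ}
    (hsm : ∀ j a b, ContDiff ℝ (⊤ : ℕ∞) fun t => ξ j t a b)
    (hinv : ∀ t : ℝ, IsUnit (stackMat N (fun j => ξ j t)))
    {w : Fin N → ℝ → Matrix (Fin 2) (Fin 2) ℂ}
    (hw : ∀ t, ξ N t + ∑ m : Fin N, w m t * ξ (N - 1 - (m : ℕ)) t = 0) (m : Fin N)
    (a b : Fin 2) : ContDiff ℝ (⊤ : ℕ∞) fun t => w m t a b := by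
  have h : ∀ t, blockRow (fun m => w m t) = -ξ N t * (stackMat N fun j => ξ j t)⁻¹ := by
    intro t
    have h0 := hw t
    rw [← blockRow_mul_stackMat (fun m => w m t) (fun j => ξ j t), add_comm,
      add_eq_zero_iff_eq_neg] at h0
    rw [← h0, Matrix.mul_nonsing_inv_cancel_right _ _
      ((Matrix.isUnit_iff_isUnit_det _).1 (hinv t))]
  have h1 : (fun t => w m t a b) = fun t =>
      (-ξ N t * (stackMat N fun j => ξ j t)⁻¹) a ⟨2 * m + b, by omega⟩ := by
    funext t
    rw [← h, blockRow_apply]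
  rw [h1]
  simp only [Matrix.mul_apply, Matrix.neg_apply]
  exact ContDiff.sum fun k _ => (hsm N a k).neg.mul
    (contDiff_matrix_inv_apply (fun i j => hsm _ _ j) hinv _ _)

/-- The Sato equation `∂_t W(λ) + λⁿ W(λ) Q = B_n(λ) W(λ)` for the monic Sato–Wilson
polynomial of the double-Wronskian construction, with `B_n(λ)` a matrix polynomial of
degree at most `n`; moreover the coefficients `w_m(t)` are smooth. -/
theorem stmt10 (N n : ℕ) (hN : 1 ≤ N) (hn : 1 ≤ n)
    (Q : Matrix (Fin 2) (Fin 2) ℂ) (hQ : Q = Matrix.diagonal ![1, -1])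
    (γ α : Matrix (Fin (2 * N)) (Fin (2 * N)) ℂ)
    (ξ : ℕ → ℝ → Matrix (Fin 2) (Fin (2 * N)) ℂ)
    (hsm : ∀ j a b, ContDiff ℝ (⊤ : ℕ∞) fun t => ξ j t a b)
    (hshift : ∀ j t, ξ (j + 1) t = ξ j t * γ)
    (hx : ∀ j t, mderiv (ξ j) t = Q * ξ (j + n) t + ξ j t * α)
    (hinv : ∀ t : ℝ, IsUnit (stackMat N (fun j => ξ j t)))
    (w : Fin N → ℝ → Matrix (Fin 2) (Fin 2) ℂ)
    (hw : ∀ t, ξ N t + ∑ m : Fin N, w m t * ξ (N - 1 - (m : ℕ)) t = 0)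
    (W : ℂ → ℝ → Matrix (Fin 2) (Fin 2) ℂ)
    (hW : ∀ lam t, W lam t = lam ^ N • (1 : Matrix (Fin 2) (Fin 2) ℂ)
        + ∑ m : Fin N, lam ^ (N - 1 - (m : ℕ)) • w m t) :
    (∀ (m : Fin N) a b, ContDiff ℝ (⊤ : ℕ∞) fun t => w m t a b)
    ∧ ∃ b : Fin (n + 1) → ℝ → Matrix (Fin 2) (Fin 2) ℂ,
        (∀ (k : Fin (n + 1)) a c, ContDiff ℝ (⊤ : ℕ∞) fun t => b k t a c)
        ∧ ∀ (lam : ℂ) (t : ℝ), mderiv (W lam) t + lam ^ n • (W lam t * Q)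
            = (∑ k : Fin (n + 1), lam ^ (k : ℕ) • b k t) * W lam t := by
  have hwsm := contDiff_of_mul_stackMat hsm hinv hw
  refine ⟨hwsm, ?_⟩
  let w₀ : Fin N → smoothMat := fun m => ⟨w m, hwsm m⟩
  let w₁ : Fin N → smoothMat := fun m => ⟨mderiv (w m), contDiff_mderiv_apply (hwsm m)⟩
  let Q₀ : smoothMat := ⟨fun _ => Q, fun _ _ => contDiff_const⟩
  let P : smoothMat[X] := monomial N 1 + ∑ m : Fin N, monomial (N - 1 - (m : ℕ)) (w₀ m)
  let R : smoothMat[X] := ∑ m : Fin N, monomial (N - 1 - (m : ℕ)) (w₁ m)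
    + (monomial (N + n) Q₀ + ∑ m : Fin N, monomial (N - 1 - (m : ℕ) + n) (w₀ m * Q₀))
  have hsum : ∀ (k M : ℕ) (c : Fin N → smoothMat), N + k ≤ M →
      (∑ m : Fin N, monomial (N - 1 - (m : ℕ) + k) (c m)).degree < M := by
    intro k M c hM
    refine (degree_sum_le _ _).trans_lt ((Finset.sup_lt_iff (WithBot.bot_lt_coe M)).2
      fun m _ => (degree_monomial_le _ _).trans_lt ?_)
    exact WithBot.coe_lt_coe.2 (by omega : N - 1 - (m : ℕ) + k < M)
  have hPdeg : P.degree < (N + 1 : ℕ) := by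
    refine (degree_add_le _ _).trans_lt (max_lt ((degree_monomial_le _ _).trans_lt ?_)
      (hsum 0 _ w₀ (by omega)))
    exact_mod_cast Nat.lt_succ_self N
  have hPcoeff : P.coeff N = 1 := by
    have := (degree_lt_iff_coeff_zero _ _).1 (hsum 0 N w₀ le_rfl) N le_rfl
    simp only [add_zero] at this
    rw [coeff_add, this, coeff_monomial, if_pos rfl, add_zero]
  have hRdeg : R.degree < (N + (n + 1) : ℕ) := by
    refine (degree_add_le _ _).trans_lt (max_lt (hsum 0 _ w₁ (by omega))
      ((degree_add_le _ _).trans_lt (max_lt ((degree_monomial_le _ _).trans_lt ?_)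
        (hsum n _ _ (by omega)))))
    exact_mod_cast (by omega : N + n < N + (n + 1))
  have hPsubst : ∀ t, coeffSubst (fun j => ξ j t) t P = 0 := by
    intro t
    simpa [P, w₀, coeffSubst_monomial] using hw t
  have hRsubst : ∀ t, coeffSubst (fun j => ξ j t) t R = 0 := by
    intro t
    have hd : HasMDerivAt (fun t => ξ N t + ∑ m : Fin N, w m t * ξ (N - 1 - (m : ℕ)) t)
        (mderiv (ξ N) t + ∑ m : Fin N, (mderiv (w m) t * ξ (N - 1 - (m : ℕ)) t
          + w m t * mderiv (ξ (N - 1 - (m : ℕ))) t)) t :=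
      (HasMDerivAt.of_contDiff (hsm N)).add (HasMDerivAt.sum _ fun m _ =>
        (HasMDerivAt.of_contDiff (hwsm m)).mul (HasMDerivAt.of_contDiff (hsm _)))
    simp only [hw] at hd
    have h0 := hd.mderiv_eq.symm.trans (HasMDerivAt.const 0).mderiv_eq
    have hα : ξ N t * α + ∑ m : Fin N, w m t * (ξ (N - 1 - (m : ℕ)) t * α) = 0 := by
      simpa [Matrix.add_mul, Matrix.sum_mul, Matrix.mul_assoc] using congrArg (· * α) (hw t)
    simp only [hx, Matrix.mul_add, Finset.sum_add_distrib] at h0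
    simp only [R, w₀, w₁, Q₀, map_add, map_sum, coeffSubst_monomial, Subring.coe_mul, Pi.mul_apply,
      Matrix.mul_assoc]
    rw [← sub_eq_zero_of_eq (h0.trans hα.symm)]
    abel
  obtain ⟨B, S, hB, hS, hdiv⟩ :=
    exists_eq_mul_monic_add hPcoeff hPdeg (n + 1) R hRdeg
  have hS0 : S = 0 := by
    refine eq_zero_of_coeffSubst_eq_zero hinv hS fun t => ?_
    have := hRsubst t
    rwa [hdiv, map_add, coeffSubst_mul_eq_zero (fun j => hshift j t) (hPsubst t), zero_add] at this
  rw [hS0, add_zero] at hdiv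
  refine ⟨fun k => (B.coeff k).1, fun k => (B.coeff k).2, fun lam t => ?_⟩
  have hevP : evalAt lam t P = W lam t := by
    simp [P, w₀, evalAt_monomial, hW]
  have hevB : evalAt lam t B = ∑ k : Fin (n + 1), lam ^ (k : ℕ) • (B.coeff k).1 t := by
    conv_lhs => rw [B.as_sum_range' (n + 1) (Nat.lt_succ_of_le <|
      natDegree_le_iff_coeff_eq_zero.2 fun k hk => (degree_lt_iff_coeff_zero _ _).1 hB k hk)]
    simp [evalAt_monomial, Finset.sum_range]
  have hevR : evalAt lam t R = mderiv (W lam) t + lam ^ n • (W lam t * Q) := by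
    have hd : HasMDerivAt (W lam)
        (0 + ∑ m : Fin N, lam ^ (N - 1 - (m : ℕ)) • mderiv (w m) t) t := by
      rw [show W lam = _ from funext (hW lam)]
      exact (HasMDerivAt.const _).add (HasMDerivAt.sum _ fun m _ =>
        (HasMDerivAt.of_contDiff (hwsm m)).const_smul _)
    rw [hd.mderiv_eq, hW]
    simp only [R, w₀, w₁, Q₀, map_add, map_sum, evalAt_monomial, Subring.coe_mul, Pi.mul_apply,
      Matrix.add_mul, Matrix.sum_mul, smul_add, Finset.smul_sum, Matrix.smul_mul, smul_smul,
      ← pow_add, zero_add, Matrix.one_mul, add_comm _ n]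
  rw [← hevR, ← hevB, ← hevP, hdiv, map_mul]
end

section
/- Fix integers N ≥ 1 and n ≥ 1, and let γ, β ∈ Matrix (Fin 2N) (Fin 2N) ℂ. Let ξ_j : ℝ² → Matrix (Fin 2) (Fin 2N) ℂ (j ∈ ℕ) be smooth functions of (y₀, s) satisfying ξ_{j+1} = ξ_j·γ and ∂_s ξ_j = ∂_{y₀} ξ_{j+n} + ξ_j·β for all j ≥ 0 and at every point. Assume that at every point the 2N × 2N matrix obtained by stacking ξ_{N−1}, …, ξ₁, ξ₀ vertically is invertible, and let w₁, …, w_N be the unique 2×2-matrix-valued functions with ξ_N + Σ_{m=1}^{N} w_m·ξ_{N−m} = 0 (these are smooth). Set W(λ, y₀, s) := I·λ^N + Σ_{m=1}^{N} w_m(y₀, s)·λ^{N−m}. Then there exist smooth matrix functions c₀, …, c_{n−1} : ℝ² → Matrix (Fin 2) (Fin 2) ℂ such that for all λ ∈ ℂ and at every point, ∂_s W(λ) − λⁿ·∂_{y₀} W(λ) = (Σ_{k=0}^{n−1} c_k·λ^k)·W(λ). -/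
/-- Partial derivative with respect to coordinate `u` of a `2 × 2N`-matrix-valued
function on `ℝ²`, taken entrywise. Coordinates: `0 = y₀`, `1 = s`. -/
noncomputable def pdXi {N : ℕ} (u : Fin 2)
    (A : (Fin 2 → ℝ) → Matrix (Fin 2) (Fin (2 * N)) ℂ) (p : Fin 2 → ℝ) :
    Matrix (Fin 2) (Fin (2 * N)) ℂ :=
  Matrix.of fun i j => deriv (fun t => A (Function.update p u t) i j) (p u)

/-- Partial derivative with respect to coordinate `u` of a `2 × 2`-matrix-valued
function on `ℝ²`, taken entrywise. -/
noncomputable def pdW (u : Fin 2)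
    (A : (Fin 2 → ℝ) → Matrix (Fin 2) (Fin 2) ℂ) (p : Fin 2 → ℝ) :
    Matrix (Fin 2) (Fin 2) ℂ :=
  Matrix.of fun i j => deriv (fun t => A (Function.update p u t) i j) (p u)

/-- A matrix-valued function on `ℝ²` is smooth if all of its entries are. -/
def SmoothEntries {ι κ : Type} (A : (Fin 2 → ℝ) → Matrix ι κ ℂ) : Prop :=
  ∀ i j, ContDiff ℝ (⊤ : ℕ∞) fun p => A p i j

namespace SmoothEntries

variable {ι κ ν : Type}

lemma add {A B : (Fin 2 → ℝ) → Matrix ι κ ℂ} (hA : SmoothEntries A) (hB : SmoothEntries B) :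
    SmoothEntries fun p => A p + B p :=
  fun i j => (hA i j).add (hB i j)

lemma sub {A B : (Fin 2 → ℝ) → Matrix ι κ ℂ} (hA : SmoothEntries A) (hB : SmoothEntries B) :
    SmoothEntries fun p => A p - B p :=
  fun i j => (hA i j).sub (hB i j)

lemma neg {A : (Fin 2 → ℝ) → Matrix ι κ ℂ} (hA : SmoothEntries A) :
    SmoothEntries fun p => -A p :=
  fun i j => (hA i j).neg

lemma zero : SmoothEntries fun _ => (0 : Matrix ι κ ℂ) := fun _ _ => contDiff_const

lemma const_smul {A : (Fin 2 → ℝ) → Matrix ι κ ℂ} (z : ℂ) (hA : SmoothEntries A) :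
    SmoothEntries fun p => z • A p :=
  fun i j => contDiff_const.mul (hA i j)

lemma mul [Fintype κ] {A : (Fin 2 → ℝ) → Matrix ι κ ℂ} {B : (Fin 2 → ℝ) → Matrix κ ν ℂ}
    (hA : SmoothEntries A) (hB : SmoothEntries B) : SmoothEntries fun p => A p * B p := by
  intro i j
  simp only [Matrix.mul_apply]
  exact ContDiff.sum fun k _ => (hA i k).mul (hB k j)

lemma sum {σ : Type} {s : Finset σ} {A : σ → (Fin 2 → ℝ) → Matrix ι κ ℂ}
    (hA : ∀ k, SmoothEntries (A k)) : SmoothEntries fun p => ∑ k ∈ s, A k p := by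
  intro i j
  simp only [Matrix.sum_apply]
  exact ContDiff.sum fun k _ => hA k i j

lemma det [Fintype ι] [DecidableEq ι] {A : (Fin 2 → ℝ) → Matrix ι ι ℂ}
    (hA : SmoothEntries A) : ContDiff ℝ (⊤ : ℕ∞) fun p => (A p).det := by
  simp only [Matrix.det_apply']
  exact ContDiff.sum fun σ _ => contDiff_const.mul (contDiff_prod fun i _ => hA _ _)

lemma inv [Fintype ι] [DecidableEq ι] {A : (Fin 2 → ℝ) → Matrix ι ι ℂ}
    (hA : SmoothEntries A) (hu : ∀ p, IsUnit (A p)) : SmoothEntries fun p => (A p)⁻¹ := by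
  intro i j
  simp only [Matrix.inv_def, Matrix.smul_apply, Ring.inverse_eq_inv', smul_eq_mul,
    Matrix.adjugate_apply]
  refine (hA.det.inv fun p => ((Matrix.isUnit_iff_isUnit_det _).1 (hu p)).ne_zero).mul ?_
  refine det fun a b => ?_
  by_cases h : a = j
  · subst h
    simpa using contDiff_const
  · simpa [Matrix.updateRow_ne h] using hA a b

end SmoothEntries

/-- Entrywise partial derivative of a matrix-valued function on `ℝ²`. -/
noncomputable def matrixPartial {ι κ : Type} (u : Fin 2) (A : (Fin 2 → ℝ) → Matrix ι κ ℂ)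
    (p : Fin 2 → ℝ) : Matrix ι κ ℂ :=
  Matrix.of fun i j => deriv (fun t => A (Function.update p u t) i j) (p u)

section matrixPartial

variable {ι κ ν : Type} (u : Fin 2)

lemma hasDerivAt_comp_update {f : (Fin 2 → ℝ) → ℂ} (hf : ContDiff ℝ (⊤ : ℕ∞) f)
    (p : Fin 2 → ℝ) :
    HasDerivAt (fun t => f (Function.update p u t)) (fderiv ℝ f p (Pi.single u 1)) (p u) := by
  have hd : HasFDerivAt f (fderiv ℝ f p) (Function.update p u (p u)) := by
    rw [Function.update_eq_self]
    exact (hf.differentiable (by simp) p).hasFDerivAt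
  exact hd.comp_hasDerivAt (p u) (hasDerivAt_update p u (p u))

lemma SmoothEntries.hasDerivAt {A : (Fin 2 → ℝ) → Matrix ι κ ℂ} (hA : SmoothEntries A)
    (p : Fin 2 → ℝ) (i : ι) (j : κ) :
    HasDerivAt (fun t => A (Function.update p u t) i j) (matrixPartial u A p i j) (p u) :=
  (hasDerivAt_comp_update u (hA i j) p).differentiableAt.hasDerivAt

lemma SmoothEntries.matrixPartial {A : (Fin 2 → ℝ) → Matrix ι κ ℂ} (hA : SmoothEntries A) :
    SmoothEntries (matrixPartial u A) := by
  intro i j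
  have h : (fun p => _root_.matrixPartial u A p i j) =
      fun p => fderiv ℝ (fun p => A p i j) p (Pi.single u 1) :=
    funext fun p => (hasDerivAt_comp_update u (hA i j) p).deriv
  rw [h]
  exact ((hA i j).fderiv_right (m := (⊤ : ℕ∞)) (by simp)).clm_apply contDiff_const

lemma matrixPartial_const (M : Matrix ι κ ℂ) (p : Fin 2 → ℝ) :
    matrixPartial u (fun _ => M) p = 0 := by
  ext i j
  simp [matrixPartial]

lemma matrixPartial_add {A B : (Fin 2 → ℝ) → Matrix ι κ ℂ} (hA : SmoothEntries A)
    (hB : SmoothEntries B) (p : Fin 2 → ℝ) :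
    matrixPartial u (fun p => A p + B p) p = matrixPartial u A p + matrixPartial u B p := by
  ext i j
  exact ((hA.hasDerivAt u p i j).add (hB.hasDerivAt u p i j)).deriv

lemma matrixPartial_const_smul (z : ℂ) {A : (Fin 2 → ℝ) → Matrix ι κ ℂ} (hA : SmoothEntries A)
    (p : Fin 2 → ℝ) :
    matrixPartial u (fun p => z • A p) p = z • matrixPartial u A p := by
  ext i j
  exact ((hA.hasDerivAt u p i j).const_mul z).deriv

lemma matrixPartial_sum {σ : Type} (s : Finset σ) {A : σ → (Fin 2 → ℝ) → Matrix ι κ ℂ}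
    (hA : ∀ k, SmoothEntries (A k)) (p : Fin 2 → ℝ) :
    matrixPartial u (fun p => ∑ k ∈ s, A k p) p = ∑ k ∈ s, matrixPartial u (A k) p := by
  ext i j
  have h := (HasDerivAt.fun_sum fun k (_ : k ∈ s) => (hA k).hasDerivAt u p i j).deriv
  simpa only [matrixPartial, Matrix.of_apply, Matrix.sum_apply] using h

lemma matrixPartial_mul [Fintype κ] {A : (Fin 2 → ℝ) → Matrix ι κ ℂ}
    {B : (Fin 2 → ℝ) → Matrix κ ν ℂ} (hA : SmoothEntries A) (hB : SmoothEntries B)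
    (p : Fin 2 → ℝ) :
    matrixPartial u (fun p => A p * B p) p =
      matrixPartial u A p * B p + A p * matrixPartial u B p := by
  ext i j
  have h := (HasDerivAt.fun_sum fun k (_ : k ∈ Finset.univ) =>
    (hA.hasDerivAt u p i k).fun_mul (hB.hasDerivAt u p k j)).deriv
  simp only [Function.update_eq_self, Finset.sum_add_distrib] at h
  simpa only [matrixPartial, Matrix.of_apply, Matrix.mul_apply, Matrix.add_apply] using h

end matrixPartial

lemma sum_range_shift_mul {ι κ ν : Type} [Fintype κ] (N n : ℕ) (f : ℕ → Matrix ι κ ℂ)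
    (x : ℕ → Matrix κ ν ℂ) :
    ∑ k ∈ Finset.range (N + n), (if n ≤ k then f (k - n) else 0) * x k =
      ∑ k ∈ Finset.range N, f k * x (k + n) := by
  rw [add_comm N n, Finset.sum_range_add, Finset.sum_eq_zero, zero_add]
  · exact Finset.sum_congr rfl fun k _ => by simp [add_comm]
  · intro k hk
    rw [if_neg (by simpa using hk), Matrix.zero_mul]

/-- Right division with remainder by the monic polynomial `λ ^ N + ∑ k < N, a k λ ^ k`,
with the powers of `λ` replaced by an arbitrary sequence `x`. -/
lemma exists_smooth_division (N n : ℕ) (a : ℕ → (Fin 2 → ℝ) → Matrix (Fin 2) (Fin 2) ℂ)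
    (ha : ∀ k, SmoothEntries (a k)) (v : ℕ → (Fin 2 → ℝ) → Matrix (Fin 2) (Fin 2) ℂ)
    (hv : ∀ k, SmoothEntries (v k)) :
    ∃ c r : ℕ → (Fin 2 → ℝ) → Matrix (Fin 2) (Fin 2) ℂ,
      (∀ k, SmoothEntries (c k)) ∧ ∀ (d : ℕ) (x : ℕ → Matrix (Fin 2) (Fin d) ℂ) p,
        ∑ k ∈ Finset.range (N + n), v k p * x k =
          ∑ k ∈ Finset.range n,
            c k p * (x (N + k) + ∑ j ∈ Finset.range N, a j p * x (j + k)) +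
          ∑ k ∈ Finset.range N, r k p * x k := by
  induction n generalizing v with
  | zero => exact ⟨fun _ _ => 0, v, fun _ => .zero, by simp⟩
  | succ n ih =>
    obtain ⟨c, r, hc, h⟩ := ih
      (fun k p => v k p - if n ≤ k then v (N + n) p * a (k - n) p else 0) fun k => by
        refine (hv k).sub ?_
        split_ifs
        · exact (hv _).mul (ha _)
        · exact .zero
    refine ⟨fun k => if k = n then v (N + n) else c k, r, fun k => ?_, fun d x p => ?_⟩
    · dsimp only
      split_ifs
      · exact hv _
      · exact hc _
    · have hs := sum_range_shift_mul N n (fun k => v (N + n) p * a k p) x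
      have hx := h d x p
      simp only [Matrix.sub_mul, Finset.sum_sub_distrib, hs] at hx
      rw [sub_eq_iff_eq_add] at hx
      rw [← add_assoc, Finset.sum_range_succ, hx, Finset.sum_range_succ _ n]
      beta_reduce
      rw [if_pos rfl]
      have hlt : ∀ k ∈ Finset.range n,
          (if k = n then v (N + n) else c k) p *
            (x (N + k) + ∑ j ∈ Finset.range N, a j p * x (j + k)) =
          c k p * (x (N + k) + ∑ j ∈ Finset.range N, a j p * x (j + k)) := fun k hk => by
        rw [if_neg (Finset.mem_range.1 hk).ne]
      rw [Finset.sum_congr rfl hlt, Matrix.mul_add, Matrix.mul_sum]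
      simp only [Matrix.mul_assoc]
      abel

lemma sum_range_two_mul {E : Type} [AddCommMonoid E] (N : ℕ) (f : ℕ → E) :
    ∑ i ∈ Finset.range (2 * N), f i = ∑ k ∈ Finset.range N, (f (2 * k) + f (2 * k + 1)) := by
  induction N with
  | zero => simp
  | succ N ih => rw [mul_add, Finset.sum_range_succ, Finset.sum_range_succ, ih,
      Finset.sum_range_succ, add_assoc]

/-- The `2 × 2N` matrix with blocks `r (N - 1), …, r 0` from left to right. -/
def rowMat (N : ℕ) (r : ℕ → Matrix (Fin 2) (Fin 2) ℂ) : Matrix (Fin 2) (Fin (2 * N)) ℂ :=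
  Matrix.of fun a i => r (N - 1 - (i : ℕ) / 2) a ⟨(i : ℕ) % 2, Nat.mod_lt _ (by norm_num)⟩

lemma rowMat_mul_stackMat (N : ℕ) (r : ℕ → Matrix (Fin 2) (Fin 2) ℂ)
    (ξ : ℕ → Matrix (Fin 2) (Fin (2 * N)) ℂ) :
    rowMat N r * stackMat N ξ = ∑ k ∈ Finset.range N, r k * ξ k := by
  ext a b
  rw [← Finset.sum_range_reflect]
  let g : ℕ → ℂ := fun i => r (N - 1 - i / 2) a ⟨i % 2, Nat.mod_lt _ (by norm_num)⟩ *
    ξ (N - 1 - i / 2) ⟨i % 2, Nat.mod_lt _ (by norm_num)⟩ b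
  calc (rowMat N r * stackMat N ξ) a b = ∑ i : Fin (2 * N), g i := by
        simp [Matrix.mul_apply, rowMat, stackMat, g]
    _ = ∑ k ∈ Finset.range N, (g (2 * k) + g (2 * k + 1)) := by
        rw [← Finset.sum_range, sum_range_two_mul]
    _ = _ := by
        rw [Matrix.sum_apply]
        refine Finset.sum_congr rfl fun k _ => ?_
        have h1 : 2 * k / 2 = k := by omega
        have h2 : (2 * k + 1) / 2 = k := by omega
        have h3 : 2 * k % 2 = 0 := by omega
        have h4 : (2 * k + 1) % 2 = 1 := by omega
        simp [Matrix.mul_apply, Fin.sum_univ_two, g, h1, h2, h3, h4]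

lemma rowMat_apply (N : ℕ) (r : ℕ → Matrix (Fin 2) (Fin 2) ℂ) {k : ℕ} (hk : k < N)
    (a b : Fin 2) :
    rowMat N r a ⟨2 * (N - 1 - k) + b, by omega⟩ = r k a b := by
  have h1 : N - 1 - (2 * (N - 1 - k) + (b : ℕ)) / 2 = k := by omega
  have h2 : (2 * (N - 1 - k) + (b : ℕ)) % 2 = b := by omega
  simp only [rowMat, Matrix.of_apply, h1, h2]

/-- The SDYM-type evolution `∂_s W(λ) − λⁿ ∂_{y₀} W(λ) = C_n(λ) W(λ)` for the monic
Sato–Wilson polynomial of the double-Wronskian construction, with `C_n(λ)` a matrix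
polynomial of degree at most `n − 1`; moreover the coefficients `w_m` are smooth. -/
theorem stmt11 (N n : ℕ) (hN : 1 ≤ N) (hn : 1 ≤ n)
    (γ β : Matrix (Fin (2 * N)) (Fin (2 * N)) ℂ)
    (ξ : ℕ → (Fin 2 → ℝ) → Matrix (Fin 2) (Fin (2 * N)) ℂ)
    (hsm : ∀ j a b, ContDiff ℝ (⊤ : ℕ∞) fun p => ξ j p a b)
    (hshift : ∀ j p, ξ (j + 1) p = ξ j p * γ)
    (hy : ∀ j p, pdXi 1 (ξ j) p = pdXi 0 (ξ (j + n)) p + ξ j p * β)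
    (hinv : ∀ p : Fin 2 → ℝ, IsUnit (stackMat N (fun j => ξ j p)))
    (w : Fin N → (Fin 2 → ℝ) → Matrix (Fin 2) (Fin 2) ℂ)
    (hw : ∀ p, ξ N p + ∑ m : Fin N, w m p * ξ (N - 1 - (m : ℕ)) p = 0)
    (W : ℂ → (Fin 2 → ℝ) → Matrix (Fin 2) (Fin 2) ℂ)
    (hW : ∀ lam p, W lam p = lam ^ N • (1 : Matrix (Fin 2) (Fin 2) ℂ)
        + ∑ m : Fin N, lam ^ (N - 1 - (m : ℕ)) • w m p) :
    (∀ (m : Fin N) a b, ContDiff ℝ (⊤ : ℕ∞) fun p => w m p a b)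
    ∧ ∃ c : Fin n → (Fin 2 → ℝ) → Matrix (Fin 2) (Fin 2) ℂ,
        (∀ (k : Fin n) a b, ContDiff ℝ (⊤ : ℕ∞) fun p => c k p a b)
        ∧ ∀ (lam : ℂ) (p : Fin 2 → ℝ),
            pdW 1 (W lam) p - lam ^ n • pdW 0 (W lam) p
              = (∑ k : Fin n, lam ^ (k : ℕ) • c k p) * W lam p := by
  change ∀ j p, matrixPartial 1 (ξ j) p = matrixPartial 0 (ξ (j + n)) p + ξ j p * β at hy
  change ∀ j, SmoothEntries (ξ j) at hsm
  obtain ⟨a, haw, ha0⟩ : ∃ a : ℕ → (Fin 2 → ℝ) → Matrix (Fin 2) (Fin 2) ℂ,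
      (∀ m : Fin N, a (N - 1 - m) = w m) ∧ ∀ k, N ≤ k → a k = fun _ => 0 := by
    refine ⟨fun k => if h : k < N then w ⟨N - 1 - k, by omega⟩ else fun _ => 0,
      fun m => ?_, fun k hk => by simp [not_lt.2 hk]⟩
    have h1 : N - 1 - (m : ℕ) < N := by omega
    have h2 : N - 1 - (N - 1 - (m : ℕ)) = m := by omega
    simp [h1, h2]
  have hreindex : ∀ (d : ℕ) (x : ℕ → Matrix (Fin 2) (Fin d) ℂ) p,
      ∑ m : Fin N, w m p * x (N - 1 - (m : ℕ)) = ∑ k ∈ Finset.range N, a k p * x k := by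
    intro d x p
    rw [← Finset.sum_range_reflect, Finset.sum_range]
    exact Finset.sum_congr rfl fun m _ => by rw [haw]
  have hstack : SmoothEntries fun p => stackMat N fun j => ξ j p := fun i j => hsm _ _ _
  have hrow : ∀ p, rowMat N (fun k => a k p) = -ξ N p * (stackMat N fun j => ξ j p)⁻¹ := by
    intro p
    have hdet := (Matrix.isUnit_iff_isUnit_det _).1 (hinv p)
    have h := hw p
    rw [hreindex _ fun k => ξ k p, ← rowMat_mul_stackMat, add_comm, add_eq_zero_iff_eq_neg] at h
    rw [← h, Matrix.mul_nonsing_inv_cancel_right _ _ hdet]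
  have ha : ∀ k, SmoothEntries (a k) := by
    intro k
    by_cases hk : k < N
    · intro i j
      have hs := (hsm N).neg.mul (hstack.inv hinv)
      simp only [← hrow] at hs
      have := hs i ⟨2 * (N - 1 - k) + j, by omega⟩
      simpa only [rowMat_apply N _ hk] using this
    · rw [ha0 k (not_lt.1 hk)]
      exact .zero
  refine ⟨fun m => haw m ▸ ha _, ?_⟩
  have hpow : ∀ j k p, ξ (j + k) p = ξ j p * γ ^ k := by
    intro j k p
    induction k with
    | zero => simp
    | succ k ih => rw [← add_assoc, hshift, ih, pow_succ, Matrix.mul_assoc]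
  have hann : ∀ k p, ξ (N + k) p + ∑ j ∈ Finset.range N, a j p * ξ (j + k) p = 0 := by
    intro k p
    have h := hw p
    rw [hreindex _ fun k => ξ k p] at h
    simp only [hpow _ k, ← Matrix.mul_assoc, ← Matrix.sum_mul, ← Matrix.add_mul, h,
      Matrix.zero_mul]
  have hdiff : ∀ u k p, matrixPartial u (ξ (N + k)) p +
      (∑ j ∈ Finset.range N, matrixPartial u (a j) p * ξ (j + k) p +
        ∑ j ∈ Finset.range N, a j p * matrixPartial u (ξ (j + k)) p) = 0 := by
    intro u k p
    have h : matrixPartial u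
        (fun p => ξ (N + k) p + ∑ j ∈ Finset.range N, a j p * ξ (j + k) p) p = 0 := by
      simp only [hann, matrixPartial_const]
    rw [matrixPartial_add u (hsm _) (.sum fun j => (ha j).mul (hsm _)),
      matrixPartial_sum u _ fun j => (ha j).mul (hsm _)] at h
    simpa only [matrixPartial_mul u (ha _) (hsm _), Finset.sum_add_distrib] using h
  have hres : ∀ p, ∑ k ∈ Finset.range N, matrixPartial 1 (a k) p * ξ k p -
      ∑ k ∈ Finset.range N, matrixPartial 0 (a k) p * ξ (k + n) p = 0 := by
    intro p
    have h1 := hdiff 1 0 p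
    have h0 := hdiff 0 n p
    have hβ := congrArg (· * β) (hann 0 p)
    simp only [add_zero, hy, Matrix.add_mul, Matrix.mul_add, Finset.sum_add_distrib,
      Matrix.sum_mul, Matrix.zero_mul, ← Matrix.mul_assoc] at h1 h0 hβ
    linear_combination (norm := module) h1 - h0 - hβ
  have hv : ∀ k, SmoothEntries fun p =>
      matrixPartial 1 (a k) p - if n ≤ k then matrixPartial 0 (a (k - n)) p else 0 := by
    intro k
    refine ((ha k).matrixPartial 1).sub ?_
    split_ifs
    · exact (ha _).matrixPartial 0
    · exact .zero
  obtain ⟨c, r, hc, hdiv⟩ := exists_smooth_division N n a ha _ hv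
  have hexpand : ∀ (d : ℕ) (x : ℕ → Matrix (Fin 2) (Fin d) ℂ) p,
      ∑ k ∈ Finset.range (N + n), (matrixPartial 1 (a k) p -
        if n ≤ k then matrixPartial 0 (a (k - n)) p else 0) * x k =
      ∑ k ∈ Finset.range N, matrixPartial 1 (a k) p * x k -
        ∑ k ∈ Finset.range N, matrixPartial 0 (a k) p * x (k + n) := by
    intro d x p
    have h : ∑ k ∈ Finset.range n, matrixPartial 1 (a (N + k)) p * x (N + k) = 0 :=
      Finset.sum_eq_zero fun k _ => by
        rw [ha0 _ (Nat.le_add_right N k), matrixPartial_const, Matrix.zero_mul]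
    simp only [Matrix.sub_mul, Finset.sum_sub_distrib,
      sum_range_shift_mul N n (fun k => matrixPartial 0 (a k) p)]
    rw [Finset.sum_range_add, h, add_zero]
  have hr : ∀ p, ∀ k < N, r k p = 0 := by
    intro p k hk
    have h := hdiv _ (fun k => ξ k p) p
    simp only [hexpand, hres, hann, Matrix.mul_zero, Finset.sum_const_zero, zero_add] at h
    rw [← rowMat_mul_stackMat N (fun k => r k p)] at h
    have hdet := (Matrix.isUnit_iff_isUnit_det _).1 (hinv p)
    have h0 : rowMat N (fun k => r k p) = 0 := by
      rw [← Matrix.mul_nonsing_inv_cancel_right _ (rowMat N fun k => r k p) hdet, ← h,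
        Matrix.zero_mul]
    ext i j
    rw [← rowMat_apply N (fun k => r k p) hk, h0]
    rfl
  have hWa : ∀ lam, W lam = fun p => lam ^ N • (1 : Matrix (Fin 2) (Fin 2) ℂ) +
      ∑ k ∈ Finset.range N, lam ^ k • a k p := by
    intro lam
    ext1 p
    have h := hreindex _ (fun k => lam ^ k • (1 : Matrix (Fin 2) (Fin 2) ℂ)) p
    simp only [Matrix.mul_smul, Matrix.mul_one] at h
    rw [hW, h]
  have hWd : ∀ u lam p, matrixPartial u (W lam) p =
      ∑ k ∈ Finset.range N, lam ^ k • matrixPartial u (a k) p := by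
    intro u lam p
    have hI : SmoothEntries fun _ => lam ^ N • (1 : Matrix (Fin 2) (Fin 2) ℂ) :=
      fun _ _ => contDiff_const
    rw [hWa, matrixPartial_add u hI (.sum fun k => (ha k).const_smul _), matrixPartial_const, zero_add,
      matrixPartial_sum u _ fun k => (ha k).const_smul _]
    simp only [matrixPartial_const_smul u _ (ha _)]
  refine ⟨fun k => c k, fun k => hc k, fun lam p => ?_⟩
  change matrixPartial 1 (W lam) p - lam ^ n • matrixPartial 0 (W lam) p = _
  have h := hdiv _ (fun k => lam ^ k • (1 : Matrix (Fin 2) (Fin 2) ℂ)) p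
  rw [hexpand, Finset.sum_eq_zero (s := Finset.range N) (f := fun k => r k p * _)
    fun k hk => by rw [hr p k (Finset.mem_range.1 hk), Matrix.zero_mul]] at h
  simp only [Matrix.mul_smul, Matrix.mul_one, add_zero] at h
  rw [hWd, hWd, Finset.smul_sum, ← Finset.sum_range fun k => lam ^ k • c k p, Finset.sum_mul, hWa]
  convert h using 2
  · exact Finset.sum_congr rfl fun k _ => by rw [smul_smul, pow_add, mul_comm]
  · simp only [pow_add, Matrix.smul_mul, ← Matrix.mul_smul, smul_add, Finset.smul_sum, smul_smul,
      mul_comm]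
end
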